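/- For every positive integer a there exist infinitely many integers b > a such that v_{a,b} < v_{a,b-1}. -/

import Mathlib

open Finset

/-- `Lab r a b` is the least common multiple of those `i ∈ {a,…,b}` with `r i ≠ 0`
(equal to `1` if there are none). -/
def Lab (r : ℕ → ℤ) (a b : ℕ) : ℕ :=
  ((Finset.Icc a b).filter fun i => r i ≠ 0).lcm id

/-- `Xab r a b = L_{a,b} · Σ_{i=a}^b r_i / i`, as an integer. -/
def Xab (r : ℕ → ℤ) (a b : ℕ) : ℤ :=
  ∑ i ∈ Finset.Icc a b, r i * ((Lab r a b / i : ℕ) : ℤ)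

def gab (r : ℕ → ℤ) (a b : ℕ) : ℕ :=
  Int.gcd (Xab r a b) (Lab r a b)

/-- `vab r a b` is the denominator of `Σ_{i=a}^b r_i / i` in lowest terms. -/
def vab (r : ℕ → ℤ) (a b : ℕ) : ℕ :=
  Lab r a b / gab r a b

/-- The partial sum `∑_{i=a}^b r_i / i`. -/
def hsum (r : ℕ → ℤ) (a b : ℕ) : ℚ :=
  ∑ i ∈ Finset.Icc a b, (r i : ℚ) / i

theorem Lab_pos (r : ℕ → ℤ) {a : ℕ} (ha : 1 ≤ a) (b : ℕ) : 0 < Lab r a b := by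
  refine Nat.pos_of_ne_zero fun h => ?_
  rw [Lab, Finset.lcm_eq_zero_iff] at h
  simp at h
  omega

theorem Xab_eq (r : ℕ → ℤ) {a : ℕ} (ha : 1 ≤ a) (b : ℕ) :
    (Xab r a b : ℚ) = Lab r a b * hsum r a b := by
  rw [Xab, hsum, Finset.mul_sum, Int.cast_sum]
  refine Finset.sum_congr rfl fun i hi => ?_
  by_cases hr : r i = 0
  · simp [hr]
  · have hdvd : i ∣ Lab r a b :=
      Finset.dvd_lcm (f := id) (Finset.mem_filter.2 ⟨hi, hr⟩)
    have hi0 : (i : ℚ) ≠ 0 := by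
      have := (Finset.mem_Icc.1 hi).1
      exact_mod_cast (by omega : i ≠ 0)
    rw [Int.cast_mul, Int.cast_natCast, Nat.cast_div hdvd hi0]
    ring

theorem vab_eq_den (r : ℕ → ℤ) {a : ℕ} (ha : 1 ≤ a) (b : ℕ) :
    vab r a b = (hsum r a b).den := by
  have hL := Lab_pos r ha b
  have hLq : (Lab r a b : ℚ) ≠ 0 := by exact_mod_cast hL.ne'
  have hx : hsum r a b = (Xab r a b : ℚ) / ((Lab r a b : ℤ) : ℚ) := by
    rw [Xab_eq r ha]
    push_cast
    field_simp
  have hg : 0 < gab r a b := Int.gcd_pos_of_ne_zero_right _ (by exact_mod_cast hL.ne')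
  rw [hx, vab]
  have hden := Rat.den_divInt (Xab r a b) (Lab r a b)
  rw [Rat.divInt_eq_div] at hden
  rw [hden, if_neg (by exact_mod_cast hL.ne'), gab, Int.gcd_comm]
  simp

theorem hsum_sub_one (r : ℕ → ℤ) {a b : ℕ} (hab : a ≤ b) (hb : 1 ≤ b) :
    hsum r a b = hsum r a (b - 1) + (r b : ℚ) / b := by
  obtain ⟨c, rfl⟩ : ∃ c, b = c + 1 := ⟨b - 1, by omega⟩
  rw [hsum, Finset.sum_Icc_succ_top hab]
  rfl

theorem den_dvd_of_mul_eq {y : ℚ} {M : ℕ} (hM : M ≠ 0) {z : ℤ} (h : y * M = z) :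
    y.den ∣ M := by
  have hM' : (M : ℚ) ≠ 0 := by exact_mod_cast hM
  have hy : y = Rat.divInt z M := by
    rw [Rat.divInt_eq_div]
    push_cast
    field_simp
    exact h
  have := Rat.den_dvd z M
  rw [← hy] at this
  exact_mod_cast this

/-- Adding `ρ / (n p ^ k)` lowers the denominator as soon as the `p`-part drops and enough of `n`
already divides the old denominator. -/
theorem den_add_lt {x y : ℚ} {ρ : ℤ} {n g p k : ℕ} (hp : p.Prime) (hn : 0 < n)
    (hxy : y = x + (ρ : ℚ) / (n * p ^ k : ℕ)) (hg : g ∣ n) (hx : p ^ k * g ∣ x.den)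
    (hy : ¬ p ^ k ∣ y.den) (hlt : n < p * g) : y.den < x.den := by
  obtain ⟨m, rfl⟩ := hg
  obtain ⟨d, hd⟩ := hx
  have hg0 : 0 < g := Nat.pos_of_mul_pos_right hn
  have hm0 : 0 < m := Nat.pos_of_mul_pos_left hn
  have hmp : m < p := by nlinarith
  have hdvd : y.den ∣ x.den * m := by
    refine den_dvd_of_mul_eq (z := x.num * m + ρ * d)
      (Nat.mul_ne_zero x.den_nz hm0.ne') ?_
    have h1 : x * x.den = x.num := Rat.mul_den_eq_num x
    have h2 : (ρ : ℚ) / (g * m * p ^ k : ℕ) * (x.den * m) = ρ * d := by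
      have hgq : (g : ℚ) ≠ 0 := by exact_mod_cast hg0.ne'
      have hmq : (m : ℚ) ≠ 0 := by exact_mod_cast hm0.ne'
      have hpq : (p : ℚ) ≠ 0 := by exact_mod_cast hp.ne_zero
      rw [hd]
      push_cast
      field_simp
    push_cast
    rw [hxy, add_mul, h2, ← mul_assoc, h1]
  obtain ⟨c, hc⟩ := hdvd
  have hpc : p ∣ c := by
    by_contra hpc
    have hcop : Nat.Coprime (p ^ k) c := Nat.Coprime.pow_left k ((Nat.Prime.coprime_iff_not_dvd hp).2 hpc)
    refine hy (hcop.dvd_of_dvd_mul_right ?_)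
    rw [← hc, hd]
    exact ⟨g * d * m, by ring⟩
  obtain ⟨c', rfl⟩ := hpc
  have hxpos := x.den_pos
  have hc' : 0 < c' := by
    rcases Nat.eq_zero_or_pos c' with h | h
    · subst h
      simp at hc
      omega
    · exact h
  have h3 : y.den * p ≤ x.den * m := by
    rw [hc]
    nlinarith [Nat.zero_le (y.den * p)]
  by_contra hcon
  push Not at hcon
  nlinarith

section Padic

variable {p : ℕ} [Fact p.Prime]

theorem padicNorm_self_zpow (z : ℤ) : padicNorm p ((p : ℚ) ^ z) = (p : ℚ) ^ (-z) := by
  have hp : p.Prime := Fact.out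
  have hp0 : (p : ℚ) ≠ 0 := by exact_mod_cast hp.ne_zero
  rw [padicNorm.eq_zpow_of_nonzero (zpow_ne_zero z hp0), padicValRat.zpow,
    padicValRat.self hp.one_lt, mul_one]

theorem pow_dvd_num_iff {e : ℕ} (he : 1 ≤ e) (x : ℚ) :
    (p : ℤ) ^ e ∣ x.num ↔ padicNorm p x ≤ (p : ℚ) ^ (-e : ℤ) := by
  have hp : p.Prime := Fact.out
  have hden : (x.den : ℚ) ≠ 0 := by exact_mod_cast x.den_nz
  have hmul : padicNorm p x * padicNorm p x.den = padicNorm p x.num := by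
    rw [← padicNorm.mul, Rat.mul_den_eq_num]
  have hdvd := padicNorm.dvd_iff_norm_le (p := p) (n := e) (z := x.num)
  push_cast at hdvd
  rw [hdvd]
  have hle : (p : ℚ) ^ (-e : ℤ) < 1 := by
    have : (1 : ℚ) < p := by exact_mod_cast hp.one_lt
    exact zpow_lt_one_of_neg₀ this (by omega)
  constructor
  · intro h
    have hpn : (p : ℤ) ∣ x.num := by
      rw [← padicNorm.int_lt_one_iff]
      exact h.trans_lt hle
    have hpd : ¬ p ∣ x.den := fun hd => by
      have h1 : p ∣ x.num.natAbs := Int.natCast_dvd.1 hpn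
      exact hp.one_lt.ne' (Nat.Coprime.eq_one_of_dvd (Nat.Coprime.coprime_dvd_left h1 x.reduced) hd)
    rw [← padicNorm.nat_eq_one_iff] at hpd
    rw [hpd, mul_one] at hmul
    rw [hmul]
    exact h
  · intro h
    rw [← hmul]
    have h1 := padicNorm.of_nat (p := p) x.den
    have h2 := padicNorm.nonneg (p := p) x
    nlinarith

theorem pow_dvd_den {k : ℕ} {x : ℚ} (h : (p : ℚ) ^ k ≤ padicNorm p x) : p ^ k ∣ x.den := by
  have hp : p.Prime := Fact.out
  have hp0 : (0 : ℚ) < p := by exact_mod_cast hp.pos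
  have hmul : padicNorm p x * padicNorm p x.den = padicNorm p x.num := by
    rw [← padicNorm.mul, Rat.mul_den_eq_num]
  have h1 := padicNorm.of_int (p := p) x.num
  have h2 := padicNorm.nonneg (p := p) (x.den : ℚ)
  have hdvd := padicNorm.dvd_iff_norm_le (p := p) (n := k) (z := x.den)
  have : (p : ℚ) ^ k * padicNorm p x.den ≤ 1 := by nlinarith
  have h3 : padicNorm p ((x.den : ℤ) : ℚ) ≤ (p : ℚ) ^ (-k : ℤ) := by
    rw [zpow_neg, zpow_natCast, ← one_div, le_div_iff₀ (by positivity), mul_comm]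
    exact_mod_cast this
  exact_mod_cast hdvd.2 h3

theorem not_pow_dvd_den {k : ℕ} (hk : 1 ≤ k) {x : ℚ}
    (h : padicNorm p x ≤ (p : ℚ) ^ ((k : ℤ) - 1)) : ¬ p ^ k ∣ x.den := by
  have hp : p.Prime := Fact.out
  have hp1 : (1 : ℚ) < p := by exact_mod_cast hp.one_lt
  intro hd
  have hmul : padicNorm p x * padicNorm p x.den = padicNorm p x.num := by
    rw [← padicNorm.mul, Rat.mul_den_eq_num]
  have hpn : ¬ (p : ℤ) ∣ x.num := fun hpn => by
    have h1 : p ∣ x.num.natAbs := Int.natCast_dvd.1 hpn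
    exact hp.one_lt.ne' (Nat.Coprime.eq_one_of_dvd (Nat.Coprime.coprime_dvd_left h1 x.reduced)
      ((dvd_pow_self p (by omega)).trans hd))
  rw [← padicNorm.int_eq_one_iff] at hpn
  have hdvd := (padicNorm.dvd_iff_norm_le (p := p) (n := k) (z := x.den)).1 (by exact_mod_cast hd)
  rw [hpn] at hmul
  have hdvd' : padicNorm p (x.den : ℚ) ≤ (p : ℚ) ^ (-k : ℤ) := by exact_mod_cast hdvd
  have h2 := padicNorm.nonneg (p := p) (x.den : ℚ)
  have h3 : (1 : ℚ) ≤ (p : ℚ) ^ ((k : ℤ) - 1) * (p : ℚ) ^ (-k : ℤ) := by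
    rw [← hmul]
    exact mul_le_mul h hdvd' h2 (by positivity)
  rw [← zpow_add₀ (by positivity)] at h3
  have h4 : (p : ℚ) ^ ((k : ℤ) - 1 + -k) < 1 := zpow_lt_one_of_neg₀ hp1 (by omega)
  linarith

/-- Isolating the terms whose index is divisible by `p ^ k`. -/
theorem exists_hsum_eq_layer (r : ℕ → ℤ) {a k : ℕ} (ha : 1 ≤ a) (hak : a ≤ p ^ k) (x : ℕ) :
    ∃ R : ℚ, padicNorm p R ≤ (p : ℚ) ^ ((k : ℤ) - 1) ∧
      hsum r a x = ((p : ℚ) ^ k)⁻¹ * hsum (fun m => r (p ^ k * m)) 1 (x / p ^ k) + R := by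
  have hp : p.Prime := Fact.out
  have hpk : 0 < p ^ k := pow_pos hp.pos k
  refine ⟨∑ i ∈ (Finset.Icc a x).filter (fun i => ¬ p ^ k ∣ i), (r i : ℚ) / i, ?_, ?_⟩
  · refine padicNorm.sum_le' (fun i hi => ?_) (by positivity)
    simp only [Finset.mem_filter, Finset.mem_Icc] at hi
    obtain ⟨⟨hi1, -⟩, hi2⟩ := hi
    rw [padicNorm.div]
    have hi0 : (i : ℚ) ≠ 0 := by exact_mod_cast (by omega : i ≠ 0)
    have hpos : 0 < padicNorm p (i : ℚ) :=
      lt_of_le_of_ne (padicNorm.nonneg _) (padicNorm.nonzero hi0).symm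
    have hnum := padicNorm.of_int (p := p) (r i)
    rw [div_le_iff₀ hpos]
    have hi3 : (p : ℚ) ^ (1 - (k : ℤ)) ≤ padicNorm p (i : ℚ) := by
      obtain ⟨z, hz⟩ := padicNorm.values_discrete (p := p) hi0
      have h1 := mt (padicNorm.dvd_iff_norm_le (p := p) (n := k) (z := i)).2
        (by exact_mod_cast hi2)
      have h1' : ¬ padicNorm p (i : ℚ) ≤ (p : ℚ) ^ (-k : ℤ) := by exact_mod_cast h1
      have hp1 : (1 : ℚ) < p := by exact_mod_cast hp.one_lt
      rw [hz] at h1' ⊢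
      rw [zpow_le_zpow_iff_right₀ hp1] at h1' ⊢
      omega
    calc padicNorm p (r i : ℚ) ≤ 1 := hnum
      _ = (p : ℚ) ^ ((k : ℤ) - 1) * (p : ℚ) ^ (1 - (k : ℤ)) := by
        rw [← zpow_add₀ (by exact_mod_cast hp.ne_zero)]
        simp
      _ ≤ _ := by gcongr
  · rw [hsum, ← Finset.sum_filter_add_sum_filter_not _ (fun i => p ^ k ∣ i), hsum, Finset.mul_sum]
    congr 1
    symm
    refine Finset.sum_bij (fun m _ => p ^ k * m) ?_ ?_ ?_ ?_
    · intro m hm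
      simp only [Finset.mem_Icc] at hm
      simp only [Finset.mem_filter, Finset.mem_Icc, dvd_mul_right, and_true]
      refine ⟨hak.trans (Nat.le_mul_of_pos_right _ hm.1), ?_⟩
      rw [mul_comm]
      exact (Nat.le_div_iff_mul_le hpk).1 hm.2
    · intro m _ m' _ h
      exact Nat.eq_of_mul_eq_mul_left hpk h
    · intro i hi
      simp only [Finset.mem_filter, Finset.mem_Icc] at hi
      obtain ⟨⟨hi1, hi2⟩, m, rfl⟩ := hi
      refine ⟨m, ?_, rfl⟩
      simp only [Finset.mem_Icc]
      refine ⟨Nat.one_le_iff_ne_zero.2 fun h => by subst h; omega, ?_⟩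
      rw [Nat.le_div_iff_mul_le hpk, mul_comm]
      exact hi2
    · intro m _
      push_cast
      rw [inv_mul_eq_div, div_div, mul_comm (m : ℚ)]

end Padic

theorem le_of_forall_pow_lt_mul_pow {x z u : ℕ} (hz : 0 < z) (h : ∀ m : ℕ, x ^ m < u * z ^ m) :
    x ≤ z := by
  by_contra! hlt
  have hz' : (0 : ℚ) < z := by exact_mod_cast hz
  have h1 : (1 : ℚ) < x / z := by
    rw [one_lt_div hz']
    exact_mod_cast hlt
  obtain ⟨m, hm⟩ := pow_unbounded_of_one_lt (u : ℚ) h1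
  rw [div_pow, lt_div_iff₀ (by positivity)] at hm
  have := h m
  have h2 : (x : ℚ) ^ m < u * z ^ m := by exact_mod_cast this
  linarith

/-- If `y` is not a power of `q`, then for infinitely many `s` the leading digit of `n y ^ s` in
base `q` is at least `u`, provided `u ^ 2 ≤ q`. -/
theorem exists_leading_digit {q y n u : ℕ} (hu : u ^ 2 ≤ q) (hq : 1 < q) (hn : 0 < n) (hy0 : 0 < y)
    (hy : ∀ i, y ≠ q ^ i) (K : ℕ) :
    ∃ s, K ≤ s ∧ ∃ j, u * q ^ j ≤ n * y ^ s ∧ n * y ^ s < q ^ (j + 1) := by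
  by_contra! hcon
  set J : ℕ → ℕ := fun s => Nat.log q (n * y ^ s) with hJ
  have hA : ∀ s, n * y ^ s ≠ 0 := fun s => (Nat.mul_pos hn (pow_pos hy0 s)).ne'
  have hlow : ∀ s, q ^ J s ≤ n * y ^ s := fun s => Nat.pow_log_le_self q (hA s)
  have hup : ∀ s, K ≤ s → n * y ^ s < u * q ^ J s := by
    intro s hs
    by_contra! h
    exact absurd (Nat.lt_pow_succ_log_self hq (n * y ^ s)) (not_lt.2 (hcon s hs (J s) h))
  have hmono : ∀ s, J s ≤ J (s + 1) := fun s =>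
    Nat.log_mono_right (Nat.mul_le_mul_left n (Nat.pow_le_pow_right hy0 (Nat.le_succ s)))
  have hsq : ∀ s, (n * y ^ (s + 1)) * (n * y ^ (s + 1)) = (n * y ^ s) * (n * y ^ (s + 2)) :=
    fun s => by ring
  have harith : ∀ s, K ≤ s → J (s + 1) + J (s + 1) = J s + J (s + 2) := by
    intro s hs
    apply le_antisymm
    · have : q ^ (J (s + 1) + J (s + 1)) < q ^ (J s + J (s + 2) + 1) := by
        calc q ^ (J (s + 1) + J (s + 1)) = q ^ J (s + 1) * q ^ J (s + 1) := pow_add _ _ _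
          _ ≤ (n * y ^ (s + 1)) * (n * y ^ (s + 1)) := Nat.mul_le_mul (hlow _) (hlow _)
          _ = (n * y ^ s) * (n * y ^ (s + 2)) := hsq s
          _ < (u * q ^ J s) * (u * q ^ J (s + 2)) :=
            Nat.mul_lt_mul_of_lt_of_le (hup s hs) (hup (s + 2) (by omega)).le
              (Nat.pos_of_ne_zero fun h => by have := hup (s + 2) (by omega); omega)
          _ = u ^ 2 * q ^ (J s + J (s + 2)) := by ring
          _ ≤ q * q ^ (J s + J (s + 2)) := Nat.mul_le_mul_right _ hu
          _ = _ := by ring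
      have := (Nat.pow_lt_pow_iff_right hq).1 this
      omega
    · have : q ^ (J s + J (s + 2)) < q ^ (J (s + 1) + J (s + 1) + 1) := by
        calc q ^ (J s + J (s + 2)) = q ^ J s * q ^ J (s + 2) := pow_add _ _ _
          _ ≤ (n * y ^ s) * (n * y ^ (s + 2)) := Nat.mul_le_mul (hlow _) (hlow _)
          _ = (n * y ^ (s + 1)) * (n * y ^ (s + 1)) := (hsq s).symm
          _ < (u * q ^ J (s + 1)) * (u * q ^ J (s + 1)) :=
            Nat.mul_lt_mul_of_lt_of_le (hup _ (by omega)) (hup _ (by omega)).le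
              (Nat.pos_of_ne_zero fun h => by have := hup (s + 1) (by omega); omega)
          _ = u ^ 2 * q ^ (J (s + 1) + J (s + 1)) := by ring
          _ ≤ q * q ^ (J (s + 1) + J (s + 1)) := Nat.mul_le_mul_right _ hu
          _ = _ := by ring
      have := (Nat.pow_lt_pow_iff_right hq).1 this
      omega
  obtain ⟨i, hi⟩ := Nat.exists_eq_add_of_le (hmono K)
  have hstep : ∀ m, J (K + m + 1) = J (K + m) + i := by
    intro m
    induction m with
    | zero => simpa using hi
    | succ m ih =>
      have := harith (K + m) (by omega)
      have e1 : K + (m + 1) + 1 = K + m + 2 := by ring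
      have e2 : K + (m + 1) = K + m + 1 := by ring
      rw [e1, e2]
      omega
  have hlin : ∀ m, J (K + m) = J K + i * m := by
    intro m
    induction m with
    | zero => simp
    | succ m ih =>
      rw [← add_assoc, hstep, ih]
      ring
  have hqK : 0 < q ^ J K := pow_pos (by omega) _
  have h1 : ∀ m : ℕ, y ^ m < u * (q ^ i) ^ m := by
    intro m
    have h := hup (K + m) (by omega)
    rw [hlin] at h
    have hl := hlow K
    refine Nat.lt_of_mul_lt_mul_left (a := q ^ J K) ?_
    calc q ^ J K * y ^ m ≤ n * y ^ K * y ^ m := Nat.mul_le_mul_right _ hl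
      _ = n * y ^ (K + m) := by ring
      _ < u * q ^ (J K + i * m) := h
      _ = _ := by ring
  have h2 : ∀ m : ℕ, (q ^ i) ^ m < u * y ^ m := by
    intro m
    have h := hlow (K + m)
    rw [hlin] at h
    have hl := hup K le_rfl
    refine Nat.lt_of_mul_lt_mul_left (a := q ^ J K) ?_
    calc q ^ J K * (q ^ i) ^ m = q ^ (J K + i * m) := by ring
      _ ≤ n * y ^ (K + m) := h
      _ = n * y ^ K * y ^ m := by ring
      _ < u * q ^ J K * y ^ m := Nat.mul_lt_mul_of_pos_right hl (pow_pos hy0 m)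
      _ = _ := by ring
  exact hy i (le_antisymm (le_of_forall_pow_lt_mul_pow (pow_pos (by omega) i) h1)
    (le_of_forall_pow_lt_mul_pow hy0 h2))

theorem eq_of_modEq_of_periodic {t : ℕ} {r : ℕ → ℤ} (hper : ∀ i, 1 ≤ i → r (i + t) = r i)
    {i j : ℕ} (hi : 1 ≤ i) (hj : 1 ≤ j) (h : i ≡ j [MOD t]) : r i = r j := by
  have key : ∀ m i : ℕ, 1 ≤ i → r (i + t * m) = r i := by
    intro m
    induction m with
    | zero => simp
    | succ m ih =>
      intro i hi
      rw [mul_add, mul_one, ← add_assoc, hper _ (by omega), ih i hi]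
  rcases le_total i j with hij | hij
  · obtain ⟨m, hm⟩ := (Nat.modEq_iff_dvd' hij).1 h
    rw [show j = i + t * m by omega, key m i hi]
  · obtain ⟨m, hm⟩ := (Nat.modEq_iff_dvd' hij).1 h.symm
    rw [show i = j + t * m by omega, key m j hj]

theorem exists_mul_ne_zero {t : ℕ} {r : ℕ → ℤ} (ht : 1 ≤ t)
    (hper : ∀ i, 1 ≤ i → r (i + t) = r i) (hnz : ∃ i, 1 ≤ i ∧ r i ≠ 0) {c : ℕ} (hc : 1 ≤ c)
    (hct : c.Coprime t) : ∃ m, 1 ≤ m ∧ m ≤ t ∧ r (c * m) ≠ 0 := by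
  obtain ⟨i, hi, hri⟩ := hnz
  have hφ : 0 < Nat.totient t := Nat.totient_pos.2 ht
  set e := i * c ^ (Nat.totient t - 1) with he
  have hce : c * e ≡ i [MOD t] := by
    have h1 : c * e = i * c ^ Nat.totient t := by
      rw [he, mul_left_comm, ← pow_succ', Nat.sub_add_cancel hφ]
    rw [h1]
    simpa using (Nat.ModEq.pow_totient hct).mul_left i
  obtain ⟨m, hm1, hmt, hm⟩ : ∃ m, 1 ≤ m ∧ m ≤ t ∧ m ≡ e [MOD t] := by
    by_cases h0 : e % t = 0
    · exact ⟨t, ht, le_rfl, by simp [Nat.ModEq, h0]⟩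
    · exact ⟨e % t, Nat.one_le_iff_ne_zero.2 h0, (Nat.mod_lt _ ht).le, Nat.mod_modEq e t⟩
  refine ⟨m, hm1, hmt, ?_⟩
  rwa [eq_of_modEq_of_periodic hper (Nat.mul_pos hc hm1) hi ((hm.mul_left c).trans hce)]

/-- The places where the denominator of the partial sums decreases. -/
def denDrops (r : ℕ → ℤ) (a : ℕ) : Set ℕ :=
  {b | a < b ∧ (hsum r a b).den < (hsum r a (b - 1)).den}

theorem denDrops_infinite_of_prime {t a : ℕ} {r : ℕ → ℤ} (ht : 1 ≤ t)
    (hper : ∀ i, 1 ≤ i → r (i + t) = r i) (ha : 1 ≤ a) {p n j : ℕ} (hp : p.Prime)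
    (hpt : p.Coprime t) (hn : 1 ≤ n) (hpn : ¬ p ∣ n) (hpr : ¬ (p : ℤ) ∣ r (p ^ j * n))
    (hT : padicNorm p (hsum (fun m => r (p ^ j * m)) 1 n) ≤ (p : ℚ)⁻¹)
    (hk : ∀ K, ∃ s, K ≤ s ∧
      ∃ g, g ∣ n ∧ n < p * g ∧ g ∣ (hsum r a (n * p ^ (j + Nat.totient t * s) - 1)).den) :
    (denDrops r a).Infinite := by
  have := Fact.mk hp
  have hp0 : (p : ℚ) ≠ 0 := by exact_mod_cast hp.ne_zero
  have hφ : 0 < Nat.totient t := Nat.totient_pos.2 ht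
  refine Set.infinite_of_forall_exists_gt fun M => ?_
  obtain ⟨s, hs, g, hgn, hng, hgd⟩ := hk (M + a + 1)
  set k := j + Nat.totient t * s with hkdef
  have hks : s ≤ k := by nlinarith
  have hk1 : 1 ≤ k := by omega
  have hpk : M + a + 1 < p ^ k := by
    have := Nat.lt_pow_self hp.one_lt (n := k)
    omega
  have hpk0 : 0 < p ^ k := by omega
  have hb : p ^ k ≤ n * p ^ k := Nat.le_mul_of_pos_left _ hn
  have hmod : p ^ k ≡ p ^ j [MOD t] := by
    rw [hkdef, pow_add, pow_mul]
    simpa using ((Nat.ModEq.pow_totient hpt).pow s).mul_left (p ^ j)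
  have hrm : ∀ m, 1 ≤ m → r (p ^ k * m) = r (p ^ j * m) := fun m hm =>
    eq_of_modEq_of_periodic hper (Nat.mul_pos hpk0 hm) (Nat.mul_pos (pow_pos hp.pos j) hm)
      (hmod.mul_right m)
  have hTeq : hsum (fun m => r (p ^ k * m)) 1 n = hsum (fun m => r (p ^ j * m)) 1 n := by
    refine Finset.sum_congr rfl fun m hm => ?_
    simp only
    rw [hrm m (Finset.mem_Icc.1 hm).1]
  obtain ⟨R, hR, hS⟩ := exists_hsum_eq_layer (p := p) r ha (k := k) (by omega) (n * p ^ k)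
  rw [Nat.mul_div_cancel _ hpk0, hTeq] at hS
  have hlow : padicNorm p (hsum r a (n * p ^ k)) ≤ (p : ℚ) ^ ((k : ℤ) - 1) := by
    rw [hS]
    refine padicNorm.nonarchimedean.trans (max_le ?_ hR)
    rw [padicNorm.mul, ← zpow_natCast, ← zpow_neg, padicNorm_self_zpow]
    rw [neg_neg, zpow_sub₀ hp0, zpow_one, div_eq_mul_inv]
    gcongr
  have hstep := hsum_sub_one r (a := a) (b := n * p ^ k) (by omega) (by omega)
  have hterm : padicNorm p ((r (n * p ^ k) : ℚ) / (n * p ^ k : ℕ)) = (p : ℚ) ^ (k : ℤ) := by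
    have h1 : padicNorm p (r (n * p ^ k) : ℚ) = 1 := by
      rw [padicNorm.int_eq_one_iff, mul_comm n, hrm n hn]
      exact hpr
    have h2 : padicNorm p (n : ℚ) = 1 := (padicNorm.nat_eq_one_iff n).2 hpn
    rw [padicNorm.div, h1]
    push_cast
    rw [padicNorm.mul, h2, ← zpow_natCast, padicNorm_self_zpow]
    simp
  have hhigh : (p : ℚ) ^ k ≤ padicNorm p (hsum r a (n * p ^ k - 1)) := by
    have hlt : (p : ℚ) ^ ((k : ℤ) - 1) < (p : ℚ) ^ (k : ℤ) :=
      zpow_lt_zpow_right₀ (by exact_mod_cast hp.one_lt) (by omega)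
    have h1 : (r (n * p ^ k) : ℚ) / (n * p ^ k : ℕ)
        = hsum r a (n * p ^ k) - hsum r a (n * p ^ k - 1) := by
      rw [hstep]
      ring
    have h2 := padicNorm.sub (p := p) (q := hsum r a (n * p ^ k)) (r := hsum r a (n * p ^ k - 1))
    rw [← h1, hterm] at h2
    rcases le_max_iff.1 h2 with h | h
    · linarith
    · exact_mod_cast h
  refine ⟨n * p ^ k, ⟨by omega, ?_⟩, by omega⟩
  refine den_add_lt hp hn hstep hgn ?_ (not_pow_dvd_den hk1 hlow) hng
  refine Nat.Coprime.mul_dvd_of_dvd_of_dvd ?_ (pow_dvd_den hhigh) hgd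
  refine Nat.Coprime.pow_left k ((Nat.Prime.coprime_iff_not_dvd hp).2 fun h => hpn (h.trans hgn))

section NoDrops

variable {t a R : ℕ} {r : ℕ → ℤ}

theorem not_dvd_of_bound (hR : ∀ i, 1 ≤ i → |r i| ≤ R) {p i : ℕ} (hp : R < p) (hi : 1 ≤ i)
    (h : r i ≠ 0) : ¬ (p : ℤ) ∣ r i := fun hd =>
  h (Int.eq_zero_of_abs_lt_dvd hd (lt_of_le_of_lt (hR i hi) (by exact_mod_cast hp)))

theorem coprime_of_prime_of_lt (ht : 1 ≤ t) {p : ℕ} (hp : p.Prime) (htp : t < p) : p.Coprime t :=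
  (Nat.Prime.coprime_iff_not_dvd hp).2 fun h => by
    have := Nat.le_of_dvd ht h
    omega

theorem top_layer_norm (ht : 1 ≤ t) (hper : ∀ i, 1 ≤ i → r (i + t) = r i) (ha : 1 ≤ a)
    (hR : ∀ i, 1 ≤ i → |r i| ≤ R) (hND : ¬ (denDrops r a).Infinite) {p n j : ℕ} (hp : p.Prime)
    (htp : t < p) (hRp : R < p) (hnp : n < p) (hne : ∃ m, 1 ≤ m ∧ m ≤ n ∧ r (p ^ j * m) ≠ 0) :
    ¬ padicNorm p (hsum (fun m => r (p ^ j * m)) 1 n) ≤ (p : ℚ)⁻¹ := by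
  intro hT
  obtain ⟨m, hm1, hmn, hm⟩ := hne
  set P : ℕ → Prop := fun m => r (p ^ j * m) ≠ 0 with hP
  set n' := Nat.findGreatest P n with hn'
  have hn'1 : 1 ≤ n' := hm1.trans (Nat.le_findGreatest hmn hm)
  have hn'n : n' ≤ n := Nat.findGreatest_le n
  have hPn' : r (p ^ j * n') ≠ 0 := Nat.findGreatest_spec (P := P) hmn hm
  have hTeq : hsum (fun m => r (p ^ j * m)) 1 n' = hsum (fun m => r (p ^ j * m)) 1 n := by
    refine Finset.sum_subset (Finset.Icc_subset_Icc_right hn'n) fun i hi hi' => ?_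
    simp only [Finset.mem_Icc, not_and, not_le] at hi hi'
    have := Nat.findGreatest_is_greatest (hi' hi.1) hi.2
    simp only [hP, not_not] at this
    simp [this]
  refine hND (denDrops_infinite_of_prime ht hper ha hp (coprime_of_prime_of_lt ht hp htp) hn'1
    (fun h => ?_) (not_dvd_of_bound hR hRp (Nat.mul_pos (pow_pos hp.pos j) hn'1) hPn')
    (hTeq ▸ hT) fun K => ⟨K, le_rfl, 1, one_dvd _, by omega, one_dvd _⟩)
  have := Nat.le_of_dvd hn'1 h
  omega

theorem pow_dvd_den_of_leading (ht : 1 ≤ t) (hper : ∀ i, 1 ≤ i → r (i + t) = r i) (ha : 1 ≤ a)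
    (hnz : ∃ i, 1 ≤ i ∧ r i ≠ 0)
    (hR : ∀ i, 1 ≤ i → |r i| ≤ R) (hND : ¬ (denDrops r a).Infinite) {p k x c : ℕ} (hp : p.Prime)
    (htp : t < p) (hRp : R < p) (hc : 1 ≤ c) (hck : c ≤ p ^ k) (hx1 : t * p ^ k ≤ x)
    (hx2 : x < p ^ (k + 1)) : p ^ k ∣ (hsum r c x).den := by
  have := Fact.mk hp
  have hp1 : (1 : ℚ) < p := by exact_mod_cast hp.one_lt
  have hpk : 0 < p ^ k := pow_pos hp.pos k
  obtain ⟨m, hm1, hmt, hm⟩ := exists_mul_ne_zero ht hper hnz hpk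
    (Nat.Coprime.pow_left k (coprime_of_prime_of_lt ht hp htp))
  have htop := top_layer_norm ht hper ha hR hND hp htp hRp (n := x / p ^ k) (j := k)
    (by rw [Nat.div_lt_iff_lt_mul hpk]; rwa [pow_succ'] at hx2)
    ⟨m, hm1, hmt.trans ((Nat.le_div_iff_mul_le hpk).2 hx1), hm⟩
  obtain ⟨Q, hQ, hS⟩ := exists_hsum_eq_layer (p := p) r hc hck x
  set T := hsum (fun m => r (p ^ k * m)) 1 (x / p ^ k)
  have hT0 : T ≠ 0 := fun h => by
    rw [h] at htop
    simp at htop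
  have hT1 : 1 ≤ padicNorm p T := by
    obtain ⟨z, hz⟩ := padicNorm.values_discrete (p := p) hT0
    rw [hz] at htop ⊢
    rw [← zpow_neg_one, zpow_le_zpow_iff_right₀ hp1] at htop
    exact one_le_zpow₀ hp1.le (by omega)
  have hTk : (p : ℚ) ^ k ≤ padicNorm p (((p : ℚ) ^ k)⁻¹ * T) := by
    rw [padicNorm.mul, ← zpow_natCast, ← zpow_neg, padicNorm_self_zpow, neg_neg]
    exact le_mul_of_one_le_right (by positivity) hT1
  have hlt : (p : ℚ) ^ ((k : ℤ) - 1) < (p : ℚ) ^ k := by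
    rw [← zpow_natCast]
    exact zpow_lt_zpow_right₀ hp1 (by omega)
  refine pow_dvd_den ?_
  rw [hS, padicNorm.add_eq_max_of_ne (by linarith [hQ.trans_lt hlt] |> ne_of_gt)]
  exact hTk.trans (le_max_left _ _)

theorem not_prime_dvd_num (ht : 1 ≤ t) (hper : ∀ i, 1 ≤ i → r (i + t) = r i) (ha : 1 ≤ a)
    (hnz : ∃ i, 1 ≤ i ∧ r i ≠ 0)
    (hR : ∀ i, 1 ≤ i → |r i| ≤ R) (hND : ¬ (denDrops r a).Infinite) {p q n : ℕ}
    (hq : q.Prime) (hRq : R < q) (htq : (t + 1) ^ 2 ≤ q) (hqn : q ∣ n) (hn : 1 ≤ n) (hrn : r n ≠ 0)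
    (hp : p.Prime) (htp : t < p) (hRp : R < p) (hnp : n < p ^ 2) :
    ¬ (p : ℤ) ∣ (hsum r 1 n).num := by
  intro hdvd
  have := Fact.mk hp
  have hp0 : (p : ℚ) ≠ 0 := by exact_mod_cast hp.ne_zero
  have hnorm : padicNorm p (hsum r 1 n) ≤ (p : ℚ)⁻¹ := by
    have := (pow_dvd_num_iff (p := p) (e := 1) le_rfl (hsum r 1 n)).1 (by simpa using hdvd)
    simpa using this
  have hnorm0 : padicNorm p (hsum (fun m => r (p ^ 0 * m)) 1 n) ≤ (p : ℚ)⁻¹ := by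
    simpa using hnorm
  by_cases hlt : n < p
  · exact top_layer_norm ht hper ha hR hND hp htp hRp hlt ⟨n, hn, le_rfl, by simpa using hrn⟩ hnorm0
  · have hpn : p ≤ n := not_lt.1 hlt
    have hKp : n / p < p := by
      rw [Nat.div_lt_iff_lt_mul hp.pos, ← sq]
      exact hnp
    obtain ⟨Q, hQ, hS⟩ := exists_hsum_eq_layer (p := p) r le_rfl (k := 1) (by simpa using hp.one_le) n
    have hzero : ∀ m, 1 ≤ m → m ≤ n / p → r (p * m) = 0 := by
      by_contra! hcon
      obtain ⟨m, hm1, hmK, hm⟩ := hcon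
      refine top_layer_norm ht hper ha hR hND hp htp hRp hKp (j := 1)
        ⟨m, hm1, hmK, by simpa using hm⟩ ?_
      have hT : hsum (fun m => r (p ^ 1 * m)) 1 (n / p) = p * (hsum r 1 n - Q) := by
        rw [hS]
        simp only [pow_one]
        field_simp
        ring
      rw [hT, padicNorm.mul, padicNorm.padicNorm_p_of_prime]
      have hQ' : padicNorm p Q ≤ 1 := by simpa using hQ
      have hle : padicNorm p (hsum r 1 n) ≤ 1 := hnorm.trans (inv_le_one_of_one_le₀
        (by exact_mod_cast hp.one_le))
      exact mul_le_of_le_one_right (by positivity) (padicNorm.sub.trans (max_le hle hQ'))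
    have hpdn : ¬ p ∣ n := by
      rintro ⟨m, rfl⟩
      refine hrn (hzero m (Nat.pos_of_mul_pos_left hn) ?_)
      rw [Nat.mul_div_cancel_left _ hp.pos]
    obtain ⟨m, hm1, hmt, hm⟩ := exists_mul_ne_zero ht hper hnz hp.one_le
      (coprime_of_prime_of_lt ht hp htp)
    have hKt : n / p < t := by
      by_contra! h
      exact hm (hzero m hm1 (hmt.trans h))
    have hntp : n < p * q := by
      rw [Nat.div_lt_iff_lt_mul hp.pos] at hKt
      nlinarith
    have hpq : p ≠ q := fun h => hpdn (h ▸ hqn)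
    have hφ : 0 < Nat.totient t := Nat.totient_pos.2 ht
    refine hND (denDrops_infinite_of_prime ht hper ha hp (coprime_of_prime_of_lt ht hp htp) hn hpdn
      (j := 0) (by simpa using not_dvd_of_bound hR hRp hn hrn) hnorm0 fun K => ?_)
    obtain ⟨s, hs, j, hj1, hj2⟩ := exists_leading_digit htq hq.one_lt hn (pow_pos hp.pos (Nat.totient t))
      (fun i h => by
        have h1 : p ∣ q ^ i := h ▸ dvd_pow_self p hφ.ne'
        exact hpq ((Nat.prime_dvd_prime_iff_eq hp hq).1 (hp.dvd_of_dvd_pow h1))) (K + a * q + q)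
    refine ⟨s, by omega, q, hqn, hntp, ?_⟩
    rw [zero_add, pow_mul]
    have hbig : s < n * (p ^ Nat.totient t) ^ s := by
      have h1 : 1 < p ^ Nat.totient t := Nat.one_lt_pow hφ.ne' hp.one_lt
      have h2 := Nat.lt_pow_self h1 (n := s)
      nlinarith
    have hqj : a * q + q < q ^ j * q := by
      rw [← pow_succ]
      omega
    have haq : a + 1 < q ^ j := by
      rw [← Nat.succ_mul] at hqj
      exact Nat.lt_of_mul_lt_mul_right hqj
    have hj0 : j ≠ 0 := by
      rintro rfl
      simp at haq
    refine (dvd_pow_self q hj0).trans (pow_dvd_den_of_leading ht hper ha hnz hR hND hq ?_ hRq ha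
      (by omega) ?_ (by omega))
    · nlinarith
    · rw [add_mul, one_mul] at hj1
      omega

end NoDrops

theorem Polynomial.eventually_pos_or_neg {P : Polynomial ℚ} (hP : P ≠ 0) :
    (∀ᶠ n : ℕ in Filter.atTop, 0 < P.eval (n : ℚ)) ∨
      ∀ᶠ n : ℕ in Filter.atTop, P.eval (n : ℚ) < 0 := by
  rcases Nat.eq_zero_or_pos P.natDegree with h0 | h0
  · rw [Polynomial.eq_C_of_natDegree_eq_zero h0] at hP ⊢
    simp only [Polynomial.eval_C]
    rcases lt_or_gt_of_ne (show P.coeff 0 ≠ 0 by simpa using hP) with h | h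
    · exact Or.inr (Filter.Eventually.of_forall fun _ => h)
    · exact Or.inl (Filter.Eventually.of_forall fun _ => h)
  · have hdeg : 0 < P.degree := Polynomial.natDegree_pos_iff_degree_pos.1 h0
    rcases le_total 0 P.leadingCoeff with h | h
    · exact Or.inl (((P.tendsto_atTop_of_leadingCoeff_nonneg hdeg h).comp
        tendsto_natCast_atTop_atTop).eventually_gt_atTop 0)
    · exact Or.inr (((P.tendsto_atBot_of_leadingCoeff_nonpos hdeg h).comp
        tendsto_natCast_atTop_atTop).eventually_lt_atBot 0)

theorem hsum_sub_hsum (r : ℕ → ℤ) {n m : ℕ} (h : n ≤ m) :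
    hsum r 1 m - hsum r 1 n = ∑ i ∈ Finset.Ioc n m, (r i : ℚ) / i := by
  have hIcc : ∀ k, Finset.Icc 1 k = Finset.Ioc 0 k := fun k => by
    ext i
    simp only [Finset.mem_Icc, Finset.mem_Ioc]
    omega
  rw [hsum, hsum, sub_eq_iff_eq_add', hIcc, hIcc, Finset.sum_Ioc_consecutive _ (Nat.zero_le n) h]

/-- Along a residue class containing an index with nonzero coefficient, the partial sums are
eventually pairwise distinct. -/
theorem exists_hsum_ne {t Q n₀ : ℕ} {r : ℕ → ℤ} (hper : ∀ i, 1 ≤ i → r (i + t) = r i)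
    (hQ : 1 ≤ Q) (htQ : t ∣ Q) (hn₀ : 1 ≤ n₀) (hr : r n₀ ≠ 0) :
    ∃ N₀, ∀ n, N₀ ≤ n → n ≡ n₀ [MOD t] → ∀ l, 1 ≤ l →
      hsum r 1 (n + Q * l) ≠ hsum r 1 n := by
  set F : Polynomial ℚ := ∑ j ∈ Finset.Icc 1 Q, Polynomial.C (r (n₀ + j) : ℚ) *
    ∏ i ∈ (Finset.Icc 1 Q).erase j, (Polynomial.X + Polynomial.C (i : ℚ)) with hF
  have hF0 : F ≠ 0 := by
    intro h
    have h1 := congrArg (Polynomial.eval (-(Q : ℚ))) h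
    rw [hF, Polynomial.eval_finsetSum, Finset.sum_eq_single Q] at h1
    · simp only [Polynomial.eval_mul, Polynomial.eval_C, Polynomial.eval_prod, Polynomial.eval_add,
        Polynomial.eval_X, Polynomial.eval_zero, mul_eq_zero, Finset.prod_eq_zero_iff] at h1
      rcases h1 with h1 | ⟨i, hi, h1⟩
      · rw [eq_of_modEq_of_periodic hper (by omega) hn₀
          (by simpa using (Nat.modEq_zero_iff_dvd.2 htQ).add_left n₀)] at h1
        exact hr (by exact_mod_cast h1)
      · have : (i : ℚ) = Q := by linarith
        exact (Finset.mem_erase.1 hi).1 (by exact_mod_cast this)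
    · intro j hj hjQ
      simp only [Polynomial.eval_mul, Polynomial.eval_prod, mul_eq_zero]
      refine Or.inr (Finset.prod_eq_zero (Finset.mem_erase.2
        ⟨Ne.symm hjQ, Finset.mem_Icc.2 ⟨hQ, le_rfl⟩⟩) (by simp))
    · intro h
      exact absurd (Finset.mem_Icc.2 ⟨hQ, le_rfl⟩) h
  have hstep : ∀ n, n ≡ n₀ [MOD t] → (hsum r 1 (n + Q) - hsum r 1 n) *
      ∏ i ∈ Finset.Icc 1 Q, ((n : ℚ) + i) = F.eval (n : ℚ) := by
    intro n hn
    rw [hsum_sub_hsum r (by omega), hF, Polynomial.eval_finsetSum, Finset.sum_mul]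
    refine (Finset.sum_bij (fun j _ => n + j) ?_ ?_ ?_ ?_).symm
    · intro j hj
      simp only [Finset.mem_Icc, Finset.mem_Ioc] at hj ⊢
      omega
    · intro j _ j' _ h
      omega
    · intro i hi
      simp only [Finset.mem_Ioc] at hi
      exact ⟨i - n, Finset.mem_Icc.2 (by omega), by omega⟩
    · intro j hj
      have hj' := Finset.mem_Icc.1 hj
      have hpos : ((n : ℚ) + j) ≠ 0 := by
        exact_mod_cast (by omega : n + j ≠ 0)
      rw [← Finset.mul_prod_erase _ _ hj,
        eq_of_modEq_of_periodic hper (i := n + j) (j := n₀ + j) (by omega) (by omega)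
          (hn.add_right j)]
      simp only [Polynomial.eval_mul, Polynomial.eval_C, Polynomial.eval_prod, Polynomial.eval_add,
        Polynomial.eval_X]
      push_cast
      field_simp
  have hprod : ∀ n : ℕ, 0 < ∏ i ∈ Finset.Icc 1 Q, ((n : ℚ) + i) := fun n =>
    Finset.prod_pos fun i hi => by
      have : 0 < n + i := by have := (Finset.mem_Icc.1 hi).1; omega
      exact_mod_cast this
  have hmod : ∀ n l, n ≡ n₀ [MOD t] → n + Q * l ≡ n₀ [MOD t] := fun n l hn => by
    simpa using hn.add (Nat.modEq_zero_iff_dvd.2 (htQ.mul_right l))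
  rcases Polynomial.eventually_pos_or_neg hF0 with h | h
  · obtain ⟨N₀, hN₀⟩ := Filter.eventually_atTop.1 h
    refine ⟨N₀, fun n hn hnt l hl => ne_of_gt ?_⟩
    induction l, hl using Nat.le_induction with
    | base =>
      have h1 := hstep n hnt ▸ hN₀ n hn
      rw [mul_one]
      linarith [pos_of_mul_pos_left h1 (hprod n).le]
    | succ l hl ih =>
      have h1 := hstep _ (hmod n l hnt) ▸ hN₀ (n + Q * l) (by omega)
      rw [mul_add, mul_one, ← add_assoc]
      linarith [pos_of_mul_pos_left h1 (hprod _).le]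
  · obtain ⟨N₀, hN₀⟩ := Filter.eventually_atTop.1 h
    refine ⟨N₀, fun n hn hnt l hl => ne_of_lt ?_⟩
    induction l, hl using Nat.le_induction with
    | base =>
      have h1 := hstep n hnt ▸ hN₀ n hn
      rw [mul_one]
      linarith [neg_of_mul_neg_left h1 (hprod n).le]
    | succ l hl ih =>
      have h1 := hstep _ (hmod n l hnt) ▸ hN₀ (n + Q * l) (by omega)
      rw [mul_add, mul_one, ← add_assoc]
      linarith [neg_of_mul_neg_left h1 (hprod _).le]

theorem exists_int_eq_hsum_sub_mul {r : ℕ → ℤ} {R : ℕ} (hR : ∀ i, 1 ≤ i → |r i| ≤ R) {n m : ℕ}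
    (h : n ≤ m) : ∃ D : ℕ, ∃ Z : ℤ, 0 < D ∧ D ≤ m ^ (m - n) ∧
      (hsum r 1 m - hsum r 1 n) * D = Z ∧ |Z| ≤ R * m ^ (m - n + 1) := by
  refine ⟨∏ i ∈ Finset.Ioc n m, i, ∑ i ∈ Finset.Ioc n m, r i * ∏ j ∈ (Finset.Ioc n m).erase i, (j : ℤ),
    Finset.prod_pos fun i hi => by have := (Finset.mem_Ioc.1 hi).1; omega, ?_, ?_, ?_⟩
  · simpa using Finset.prod_le_pow_card (Finset.Ioc n m) id m fun i hi => (Finset.mem_Ioc.1 hi).2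
  · rw [hsum_sub_hsum r h, Finset.sum_mul]
    push_cast
    refine Finset.sum_congr rfl fun i hi => ?_
    have hi0 : (i : ℚ) ≠ 0 := by
      have := (Finset.mem_Ioc.1 hi).1
      exact_mod_cast (by omega : i ≠ 0)
    rw [← Finset.mul_prod_erase _ _ hi]
    field_simp
  · rcases h.eq_or_lt with rfl | hlt
    · simpa using by positivity
    have hterm : ∀ i ∈ Finset.Ioc n m,
        |r i * ∏ j ∈ (Finset.Ioc n m).erase i, (j : ℤ)| ≤ R * (m : ℤ) ^ (m - n) := by
      intro i hi
      have hi' := Finset.mem_Ioc.1 hi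
      rw [abs_mul]
      refine mul_le_mul (hR i (by omega)) ?_ (abs_nonneg _) (by positivity)
      rw [Finset.abs_prod]
      have h1 : ∏ j ∈ (Finset.Ioc n m).erase i, j ≤ m ^ ((Finset.Ioc n m).erase i).card :=
        Finset.prod_le_pow_card _ _ m fun j hj => (Finset.mem_Ioc.1 (Finset.mem_of_mem_erase hj)).2
      have h2 : m ^ ((Finset.Ioc n m).erase i).card ≤ m ^ (m - n) :=
        Nat.pow_le_pow_right (by omega) (by simpa using Finset.card_erase_le (s := Finset.Ioc n m))
      simp only [Nat.abs_cast]
      rw [← Nat.cast_prod]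
      exact_mod_cast h1.trans h2
    refine (Finset.abs_sum_le_sum_abs _ _).trans ((Finset.sum_le_card_nsmul _ _ _ hterm).trans ?_)
    rw [Nat.card_Ioc, nsmul_eq_mul, pow_succ]
    have h1 : ((m - n : ℕ) : ℤ) ≤ m := by exact_mod_cast Nat.sub_le m n
    have h2 : (0 : ℤ) ≤ R * (m : ℤ) ^ (m - n) := by positivity
    nlinarith

theorem one_le_abs_hsum_sub_mul {r : ℕ → ℤ} {R : ℕ} (hR : ∀ i, 1 ≤ i → |r i| ≤ R) {n m : ℕ}
    (h : n ≤ m) (hne : hsum r 1 m ≠ hsum r 1 n) :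
    1 ≤ |hsum r 1 m - hsum r 1 n| * (m : ℚ) ^ (m - n) := by
  obtain ⟨D, Z, hD, hDm, hZ, -⟩ := exists_int_eq_hsum_sub_mul hR h
  have hD0 : (D : ℚ) ≠ 0 := by exact_mod_cast hD.ne'
  have hZ0 : Z ≠ 0 := by
    rintro rfl
    simp [hD0, sub_eq_zero, hne] at hZ
  have h1 : (1 : ℚ) ≤ |(Z : ℚ)| := by exact_mod_cast Int.one_le_abs hZ0
  rw [← hZ, abs_mul, Nat.abs_cast] at h1
  refine h1.trans (mul_le_mul_of_nonneg_left ?_ (abs_nonneg _))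
  exact_mod_cast hDm

theorem pow_le_of_dvd_num_num {r : ℕ → ℤ} {R : ℕ} (hR : ∀ i, 1 ≤ i → |r i| ≤ R) {n m p e : ℕ}
    (h : n ≤ m) (hne : hsum r 1 m ≠ hsum r 1 n) (hp : p.Prime) (he : 1 ≤ e)
    (hn : (p : ℤ) ^ e ∣ (hsum r 1 n).num) (hm : (p : ℤ) ^ e ∣ (hsum r 1 m).num) :
    p ^ e ≤ R * m ^ (m - n + 1) := by
  have := Fact.mk hp
  obtain ⟨D, Z, hD, -, hZ, hZm⟩ := exists_int_eq_hsum_sub_mul hR h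
  have hD0 : (D : ℚ) ≠ 0 := by exact_mod_cast hD.ne'
  have hZ0 : Z ≠ 0 := by
    rintro rfl
    simp [hD0, sub_eq_zero, hne] at hZ
  have hdvd : (p : ℤ) ^ e ∣ Z := by
    have h1 := (padicNorm.dvd_iff_norm_le (p := p) (n := e) (z := Z)).2 (by
      rw [← hZ, padicNorm.mul]
      refine (mul_le_of_le_one_right (padicNorm.nonneg _) (padicNorm.of_nat D)).trans
        (padicNorm.sub.trans (max_le ((pow_dvd_num_iff he _).1 hm) ((pow_dvd_num_iff he _).1 hn))))
    exact_mod_cast h1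
  have h2 := Int.le_of_dvd (abs_pos.2 hZ0) ((dvd_abs _ _).2 hdvd)
  exact_mod_cast h2.trans hZm

theorem Nat.le_pow_card_of_factorization {x H : ℕ} {P : Finset ℕ} (hx : x ≠ 0) (hH : 1 ≤ H)
    (hP : x.primeFactors ⊆ P) (h : ∀ p ∈ P, p ^ x.factorization p ≤ H) : x ≤ H ^ P.card := by
  calc x = ∏ p ∈ x.primeFactors, p ^ x.factorization p :=
        (Nat.prod_factorization_pow_eq_self hx).symm
    _ ≤ H ^ x.primeFactors.card :=
        Finset.prod_le_pow_card _ _ _ fun p hp => h p (hP hp)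
    _ ≤ H ^ P.card := Nat.pow_le_pow_right hH (Finset.card_le_card hP)

/-- Among `#P + 2` partial sums in an arithmetic progression, one is neither too small nor has a
numerator divisible by a large power of a prime in `P`. -/
theorem exists_hsum_not_small {r : ℕ → ℤ} {R Q N M : ℕ} (hR : ∀ i, 1 ≤ i → |r i| ≤ R)
    (hR1 : 1 ≤ R) {P : Finset ℕ} (hP : ∀ p ∈ P, p.Prime) (hM : 1 ≤ M)
    (hNM : N + Q * (P.card + 2) ≤ M)
    (hne : ∀ s l, 1 ≤ l → hsum r 1 (N + Q * s + Q * l) ≠ hsum r 1 (N + Q * s)) :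
    ∃ s, s < P.card + 2 ∧
      1 ≤ |hsum r 1 (N + Q * s)| * (2 * (M : ℚ) ^ (Q * (P.card + 2))) ∧
      ∀ p ∈ P, p ^ (hsum r 1 (N + Q * s)).num.natAbs.factorization p ≤
        R * M ^ (Q * (P.card + 2) + 1) := by
  set w := P.card + 2 with hw
  set S : ℕ → ℚ := fun s => hsum r 1 (N + Q * s) with hS
  set H := R * M ^ (Q * w + 1) with hH
  have hH1 : 1 ≤ H := Nat.mul_pos hR1 (pow_pos hM _)
  by_contra! hcon
  have hbad : ∀ s, s < w → ∃ c, (c = 0 ∧ |S s| * (2 * (M : ℚ) ^ (Q * w)) < 1) ∨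
      (c ∈ P ∧ H < c ^ (S s).num.natAbs.factorization c) := by
    intro s hs
    by_cases h : 1 ≤ |S s| * (2 * (M : ℚ) ^ (Q * w))
    · obtain ⟨c, hc, hc'⟩ := hcon s hs h
      exact ⟨c, Or.inr ⟨hc, hc'⟩⟩
    · exact ⟨0, Or.inl ⟨rfl, not_le.1 h⟩⟩
  choose! f hf using hbad
  have key : ∀ s s', s < s' → s' < w → f s ≠ f s' := by
    intro s s' hss hs' hff
    obtain ⟨l, rfl⟩ := Nat.exists_eq_add_of_lt hss
    have hidx : N + Q * (s + l + 1) = N + Q * s + Q * (l + 1) := by ring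
    have hle : N + Q * s ≤ N + Q * (s + l + 1) := by omega
    have hne' : hsum r 1 (N + Q * (s + l + 1)) ≠ hsum r 1 (N + Q * s) := by
      rw [hidx]
      exact hne s (l + 1) (by omega)
    have hmM : N + Q * (s + l + 1) ≤ M :=
      (Nat.add_le_add_left (Nat.mul_le_mul_left Q hs'.le) N).trans hNM
    have hdiff : N + Q * (s + l + 1) - (N + Q * s) ≤ Q * w := by
      have := Nat.mul_le_mul_left Q hs'.le
      omega
    have hpow : ∀ i j, i ≤ j → (N + Q * (s + l + 1)) ^ i ≤ M ^ j := fun i j hij =>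
      (Nat.pow_le_pow_left hmM i).trans (Nat.pow_le_pow_right hM hij)
    rcases hf s (hss.trans hs') with ⟨hc, h1⟩ | ⟨hc, h1⟩ <;>
      rcases hf _ hs' with ⟨hc', h2⟩ | ⟨hc', h2⟩
    · have h3 := one_le_abs_hsum_sub_mul hR hle hne'
      have h4 : (((N + Q * (s + l + 1) : ℕ) : ℚ)) ^ (N + Q * (s + l + 1) - (N + Q * s))
          ≤ (M : ℚ) ^ (Q * w) := by exact_mod_cast hpow _ _ hdiff
      have h5 := h3.trans (mul_le_mul_of_nonneg_left h4 (abs_nonneg _))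
      have h6 := abs_sub (S (s + l + 1)) (S s)
      have h7 : (0 : ℚ) ≤ (M : ℚ) ^ (Q * w) := by positivity
      simp only [hS] at h1 h2 h6
      nlinarith
    · rw [← hff, hc] at hc'
      exact Nat.not_prime_zero (hP _ hc')
    · rw [hff, hc'] at hc
      exact Nat.not_prime_zero (hP _ hc)
    · rw [← hff] at hc' h2
      set c := f s
      have hcp := hP c hc
      set e := min ((S s).num.natAbs.factorization c) ((S (s + l + 1)).num.natAbs.factorization c)
        with he
      have hHe : H < c ^ e := by
        rcases min_choice ((S s).num.natAbs.factorization c)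
          ((S (s + l + 1)).num.natAbs.factorization c) with h | h
        · rwa [he, h]
        · rwa [he, h]
      have he1 : 1 ≤ e := Nat.one_le_iff_ne_zero.2 fun h => by
        rw [h, pow_zero] at hHe
        omega
      have hdvd : ∀ x : ℤ, e ≤ x.natAbs.factorization c → (c : ℤ) ^ e ∣ x := fun x hx => by
        have := (pow_dvd_pow c hx).trans (Nat.ordProj_dvd x.natAbs c)
        exact_mod_cast Int.natCast_dvd.2 this
      have h3 := pow_le_of_dvd_num_num hR hle hne' hcp he1 (hdvd _ (min_le_left _ _))
        (hdvd _ (min_le_right _ _))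
      exact absurd (h3.trans (Nat.mul_le_mul_left R (hpow _ (Q * w + 1) (by omega)))) (not_le.2 hHe)
  obtain ⟨s, hs, s', hs', hss, hff⟩ := Finset.exists_ne_map_eq_of_card_lt_of_maps_to
    (s := Finset.range w) (t := insert 0 P) (f := f)
    (by
      have := Finset.card_insert_le 0 P
      rw [Finset.card_range]
      omega)
    (fun s hs => by
      rcases hf s (Finset.mem_range.1 hs) with ⟨hc, -⟩ | ⟨hc, -⟩
      · simp [hc]
      · exact Finset.mem_insert_of_mem hc)
  rcases lt_or_gt_of_ne hss with h | h
  · exact key s s' h (Finset.mem_range.1 hs') hff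
  · exact key s' s h (Finset.mem_range.1 hs) hff.symm

theorem primorial_le_of_not_infinite {t a R : ℕ} {r : ℕ → ℤ} (ht : 1 ≤ t)
    (hper : ∀ i, 1 ≤ i → r (i + t) = r i) (ha : 1 ≤ a) (hnz : ∃ i, 1 ≤ i ∧ r i ≠ 0)
    (hR : ∀ i, 1 ≤ i → |r i| ≤ R) (hR1 : 1 ≤ R) (hND : ¬ (denDrops r a).Infinite)
    {q Q N y u : ℕ} (hq : q.Prime) (hRq : R < q) (htq : (t + 1) ^ 2 ≤ q) (hty : t ≤ y) (hRy : R ≤ y)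
    (hN : 1 ≤ N) (hqN : ∀ s, q ∣ N + Q * s) (hrN : ∀ s, r (N + Q * s) ≠ 0)
    (hNy : N + Q * (y.primeCounting + 2) ≤ y ^ 2) (hu : t * u ≤ N)
    (hne : ∀ s l, 1 ≤ l → hsum r 1 (N + Q * s + Q * l) ≠ hsum r 1 (N + Q * s)) :
    primorial u ≤ (R * (y ^ 2) ^ (Q * (y.primeCounting + 2) + 1)) ^ y.primeCounting *
      (2 * (y ^ 2) ^ (Q * (y.primeCounting + 2))) * 4 ^ y := by
  have hM : 1 ≤ y ^ 2 := by omega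
  rw [← Nat.primesLE_card_eq_primeCounting] at hNy ⊢
  obtain ⟨s, hs, hsmall, hfac⟩ := exists_hsum_not_small hR hR1
    (P := Nat.primesLE y) (fun p hp => Nat.prime_of_mem_primesLE hp) hM hNy hne
  set w := (Nat.primesLE y).card + 2
  set n := N + Q * s with hn
  set x := hsum r 1 n with hx
  set H := R * (y ^ 2) ^ (Q * w + 1)
  have hny : n ≤ y ^ 2 := (Nat.add_le_add_left (Nat.mul_le_mul_left Q hs.le) N).trans hNy
  have hx0 : x ≠ 0 := fun h => by
    rw [h] at hsmall
    norm_num at hsmall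
  have hlt : ∀ p, y < p → n < p ^ 2 := fun p hp => hny.trans_lt (Nat.pow_lt_pow_left hp two_ne_zero)
  have hnum : x.num.natAbs ≤ H ^ (Nat.primesLE y).card := by
    refine Nat.le_pow_card_of_factorization (by simpa using hx0)
      (Nat.mul_pos hR1 (pow_pos hM _)) (fun p hp => ?_) hfac
    have hpp := Nat.prime_of_mem_primeFactors hp
    refine Nat.mem_primesLE.2 ⟨?_, hpp⟩
    by_contra! hyp
    exact not_prime_dvd_num ht hper ha hnz hR hND hq hRq htq (hqN s) (by omega) (hrN s) hpp
      (by omega) (by omega) (hlt p hyp) (Int.natCast_dvd.2 (Nat.dvd_of_mem_primeFactors hp))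
  have hden : x.den ≤ x.num.natAbs * (2 * (y ^ 2) ^ (Q * w)) := by
    have h1 : |x| * x.den = x.num.natAbs := by
      rw [← Nat.abs_cast x.den, ← abs_mul, Rat.mul_den_eq_num, Nat.cast_natAbs, Int.cast_abs]
    have h2 : (x.den : ℚ) ≤ x.num.natAbs * (2 * ((y ^ 2 : ℕ) : ℚ) ^ (Q * w)) := by
      rw [← h1]
      nlinarith [Nat.cast_nonneg (α := ℚ) x.den]
    exact_mod_cast h2
  have hdvd : primorial u ∣ x.den * primorial y := by
    rw [primorial_eq_prod_primesLE u]
    refine Finset.prod_primes_dvd _ (fun p hp => (Nat.prime_of_mem_primesLE hp).prime) fun p hp => ?_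
    have hpp := Nat.prime_of_mem_primesLE hp
    have hpu := Nat.le_of_mem_primesLE hp
    rcases le_or_gt p y with hpy | hpy
    · exact (hpp.dvd_primorial_iff.2 hpy).mul_left _
    · refine Dvd.dvd.mul_right ?_ _
      have h1 := Nat.mul_le_mul_left t hpu
      simpa using pow_dvd_den_of_leading ht hper ha hnz hR hND (k := 1) (c := 1) (x := n) hpp
        (by omega) (by omega) le_rfl (by simpa using hpp.one_le) (by rw [pow_one]; omega)
        (hlt p hpy)
  calc primorial u ≤ x.den * primorial y :=
        Nat.le_of_dvd (Nat.mul_pos x.den_pos (primorial_pos y)) hdvd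
    _ ≤ _ := Nat.mul_le_mul (hden.trans (Nat.mul_le_mul_right _ hnum)) (primorial_le_four_pow y)

theorem eventually_half_le_theta : ∀ᶠ u : ℕ in Filter.atTop, (u : ℝ) / 2 ≤ Chebyshev.theta u := by
  have hlog := (isLittleO_log_rpow_atTop (r := 1 / 2) (by norm_num)).bound
    (show (0 : ℝ) < 1 / 100 by norm_num)
  filter_upwards [tendsto_natCast_atTop_atTop.eventually hlog, Filter.eventually_ge_atTop 100]
    with u hu hu1
  have hu1' : (100 : ℝ) ≤ u := by exact_mod_cast hu1
  have hs : √(u : ℝ) * √(u : ℝ) = u := Real.mul_self_sqrt (by positivity)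
  have hs0 : 0 ≤ √(u : ℝ) := Real.sqrt_nonneg _
  have hs10 : 10 ≤ √(u : ℝ) := Real.le_sqrt_of_sq_le (by linarith)
  have h1 : Real.log u ≤ 1 / 100 * √(u : ℝ) := by
    rw [← Real.sqrt_eq_rpow] at hu
    rw [Real.norm_of_nonneg hs0] at hu
    exact (Real.le_norm_self _).trans hu
  have h2 : Real.log ((u : ℝ) + 1) ≤ 1 + Real.log u := by
    have h3 : Real.log ((u : ℝ) + 1) ≤ Real.log (2 * u) :=
      Real.log_le_log (by positivity) (by linarith)
    rw [Real.log_mul two_ne_zero (by positivity)] at h3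
    linarith [Real.log_two_lt_d9]
  have h4 := Chebyshev.theta_ge u
  have h5 : √(u : ℝ) * Real.log u ≤ 1 / 100 * u := by nlinarith
  have h6 : (u : ℝ) * 0.69 ≤ u * Real.log 2 :=
    mul_le_mul_of_nonneg_left (by linarith [Real.log_two_gt_d9]) (by positivity)
  nlinarith

theorem eventually_primeCounting_mul_log_le :
    ∀ᶠ y : ℕ in Filter.atTop, (y.primeCounting : ℝ) * Real.log y ≤ 2 * y := by
  have h := tendsto_natCast_atTop_atTop.eventually
    (Chebyshev.eventually_primeCounting_le (ε := 1 / 2) (by norm_num))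
  filter_upwards [h, Filter.eventually_ge_atTop 2] with y hy hy2
  have hy2' : (2 : ℝ) ≤ y := by exact_mod_cast hy2
  rw [Nat.floor_natCast, le_div_iff₀ (Real.log_pos (by linarith))] at hy
  have h4 : Real.log 4 = 2 * Real.log 2 := by
    rw [show (4 : ℝ) = 2 ^ 2 by norm_num, Real.log_pow]
    norm_num
  refine hy.trans (mul_le_mul_of_nonneg_right ?_ (by positivity))
  linarith [Real.log_two_lt_d9]

theorem eventually_lt_primorial {t Q R : ℕ} (ht : 1 ≤ t) (hQ : 1 ≤ Q) (hR : 1 ≤ R) :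
    ∀ᶠ y : ℕ in Filter.atTop,
      (R * (y ^ 2) ^ (Q * (y.primeCounting + 2) + 1)) ^ y.primeCounting *
        (2 * (y ^ 2) ^ (Q * (y.primeCounting + 2))) * 4 ^ y < primorial (y ^ 2 / (2 * t)) := by
  have htend : Filter.Tendsto (fun y : ℕ => y ^ 2 / (2 * t)) Filter.atTop Filter.atTop :=
    (Nat.tendsto_div_const_atTop (by omega)).comp (Filter.tendsto_pow_atTop two_ne_zero)
  have hlogt := (Real.tendsto_log_atTop.comp tendsto_natCast_atTop_atTop).eventually_ge_atTop
    (128 * Q * t : ℝ)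
  set K : ℝ := Real.log R + 16 * Q + 7 with hK
  filter_upwards [htend.eventually eventually_half_le_theta, eventually_primeCounting_mul_log_le,
    hlogt, Filter.eventually_ge_atTop (4 * t),
    tendsto_natCast_atTop_atTop.eventually_gt_atTop (16 * t * K)] with y hθ hπ hlog hyt hyK
  simp only [Function.comp_apply] at hlog
  set u := y ^ 2 / (2 * t) with hu
  set p := y.primeCounting with hp
  have ht' : (1 : ℝ) ≤ t := by exact_mod_cast ht
  have hQ' : (1 : ℝ) ≤ Q := by exact_mod_cast hQ
  have hR' : (1 : ℝ) ≤ R := by exact_mod_cast hR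
  have hyt' : (4 : ℝ) * t ≤ y := by exact_mod_cast hyt
  have hy1 : (1 : ℝ) ≤ y := by linarith
  have hlogy : Real.log y ≤ y := (Real.log_le_sub_one_of_pos (by linarith)).trans (by linarith)
  have hlogR : 0 ≤ Real.log R := Real.log_nonneg hR'
  have hp0 : (0 : ℝ) ≤ p := by positivity
  have hpQ : (p : ℝ) * (64 * Q * t) ≤ y := by nlinarith
  have hpy : (p : ℝ) ≤ y := by
    have : (1 : ℝ) ≤ 64 * Q * t := by nlinarith
    nlinarith
  have hu1 : (y : ℝ) ^ 2 / (4 * t) ≤ u := by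
    have h1 : y ^ 2 < 2 * t * (u + 1) := by
      have := Nat.lt_mul_div_succ (y ^ 2) (b := 2 * t) (by omega)
      exact this
    have h2 : (y : ℝ) ^ 2 < 2 * t * (u + 1) := by exact_mod_cast h1
    rw [div_le_iff₀ (by positivity)]
    nlinarith
  have hmain : (p : ℝ) * (Real.log R + (Q * (p + 2) + 1) * (2 * Real.log y)) +
      (Real.log 2 + Q * (p + 2) * (2 * Real.log y)) + y * Real.log 4 < Chebyshev.theta u := by
    have hL4 : Real.log 4 ≤ 2 := by
      rw [show (4 : ℝ) = 2 ^ 2 by norm_num, Real.log_pow]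
      push_cast
      linarith [Real.log_two_lt_d9]
    have e1 : (p : ℝ) * Real.log R ≤ y * Real.log R := mul_le_mul_of_nonneg_right hpy hlogR
    have e2 : (Q : ℝ) * p * (p * Real.log y) ≤ Q * p * (2 * y) :=
      mul_le_mul_of_nonneg_left hπ (by positivity)
    have e3 : (Q : ℝ) * (p * Real.log y) ≤ Q * (2 * y) :=
      mul_le_mul_of_nonneg_left hπ (by positivity)
    have e4 : (Q : ℝ) * Real.log y ≤ Q * y := mul_le_mul_of_nonneg_left hlogy (by positivity)
    have e5 : (y : ℝ) * Real.log 4 ≤ y * 2 := mul_le_mul_of_nonneg_left hL4 (by positivity)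
    have e6 : (4 : ℝ) * Q * p * y ≤ y ^ 2 / (16 * t) := by
      rw [le_div_iff₀ (by positivity)]
      nlinarith
    have e7 : K * y < (y : ℝ) ^ 2 / (16 * t) := by
      rw [lt_div_iff₀ (by positivity)]
      nlinarith
    have e8 : (y : ℝ) ^ 2 / (4 * t) / 2 = (y : ℝ) ^ 2 / (16 * t) + (y : ℝ) ^ 2 / (16 * t) := by
      field_simp
      norm_num
    have e9 : (y : ℝ) * Real.log R + 16 * Q * y + 7 * y = K * y := by
      rw [hK]
      ring
    linarith [Real.log_two_lt_d9]
  rw [Chebyshev.theta_eq_log_primorial, Nat.floor_natCast] at hmain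
  have hy0 : (y : ℝ) ≠ 0 := by positivity
  have hR0 : (R : ℝ) ≠ 0 := by positivity
  have hexp : Real.log ((((R * (y ^ 2) ^ (Q * (p + 2) + 1)) ^ p *
      (2 * (y ^ 2) ^ (Q * (p + 2))) * 4 ^ y : ℕ) : ℝ)) =
      (p : ℝ) * (Real.log R + (Q * (p + 2) + 1) * (2 * Real.log y)) +
      (Real.log 2 + Q * (p + 2) * (2 * Real.log y)) + y * Real.log 4 := by
    push_cast
    rw [Real.log_mul (by positivity) (by positivity), Real.log_mul (by positivity) (by positivity),
      Real.log_pow, Real.log_mul hR0 (by positivity), Real.log_mul two_ne_zero (by positivity),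
      Real.log_pow, Real.log_pow, Real.log_pow, Real.log_pow, Real.log_pow]
    push_cast
    ring
  rw [← hexp] at hmain
  have := (Real.log_lt_log_iff (by push_cast; positivity) (by exact_mod_cast primorial_pos u)).1 hmain
  exact_mod_cast this

theorem exists_abs_le_of_periodic {t : ℕ} {r : ℕ → ℤ} (ht : 1 ≤ t)
    (hper : ∀ i, 1 ≤ i → r (i + t) = r i) : ∃ R : ℕ, 1 ≤ R ∧ ∀ i, 1 ≤ i → |r i| ≤ R := by
  refine ⟨1 + ∑ j ∈ Finset.Icc 1 t, (r j).natAbs, by omega, fun i hi => ?_⟩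
  obtain ⟨j, hj, hij⟩ : ∃ j ∈ Finset.Icc 1 t, i ≡ j [MOD t] := by
    by_cases h0 : i % t = 0
    · exact ⟨t, Finset.mem_Icc.2 ⟨ht, le_rfl⟩, by simp [Nat.ModEq, h0]⟩
    · exact ⟨i % t, Finset.mem_Icc.2 ⟨Nat.one_le_iff_ne_zero.2 h0, (Nat.mod_lt _ ht).le⟩,
        (Nat.mod_modEq i t).symm⟩
  have h1 := Finset.single_le_sum (f := fun j => (r j).natAbs) (fun _ _ => Nat.zero_le _) hj
  rw [eq_of_modEq_of_periodic hper hi (Finset.mem_Icc.1 hj).1 hij, Int.abs_eq_natAbs]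
  exact_mod_cast h1.trans (Nat.le_add_left _ 1)

theorem denDrops_infinite {t a : ℕ} {r : ℕ → ℤ} (ht : 1 ≤ t)
    (hper : ∀ i, 1 ≤ i → r (i + t) = r i) (hnz : ∃ i, 1 ≤ i ∧ r i ≠ 0) (ha : 1 ≤ a) :
    (denDrops r a).Infinite := by
  by_contra hND
  obtain ⟨R, hR1, hR⟩ := exists_abs_le_of_periodic ht hper
  obtain ⟨q, hqge, hq⟩ := Nat.exists_infinite_primes (R + 1 + (t + 1) ^ 2)
  have htq : t < q := by nlinarith
  obtain ⟨i, hi, hri⟩ := id hnz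
  have hφ : 0 < Nat.totient t := Nat.totient_pos.2 ht
  set n₀ := q ^ Nat.totient t * i
  have hn₀ : 1 ≤ n₀ := Nat.mul_pos (pow_pos hq.pos _) hi
  have hmod : n₀ ≡ i [MOD t] := by
    simpa using (Nat.ModEq.pow_totient (coprime_of_prime_of_lt ht hq htq)).mul_right i
  have hrn₀ : r n₀ ≠ 0 := by rwa [eq_of_modEq_of_periodic hper hn₀ hi hmod]
  have hQ : 1 ≤ t * q := Nat.mul_pos ht hq.pos
  have hmodQ : ∀ s, n₀ + t * q * s ≡ n₀ [MOD t] := fun s => by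
    simp [Nat.ModEq, mul_assoc]
  obtain ⟨N₀, hN₀⟩ := exists_hsum_ne hper hQ (dvd_mul_right t q) hn₀ hrn₀
  obtain ⟨y, hy, hyge⟩ := ((eventually_lt_primorial ht hQ hR1).and
    (Filter.eventually_ge_atTop (2 * N₀ + 2 * n₀ + 8 * (t * q) + R + t))).exists
  set Q := t * q
  set w := y.primeCounting + 2 with hw
  have hpy : y.primeCounting ≤ y := by
    rw [← Nat.primesLE_card_eq_primeCounting, Nat.primesLE_eq_filter_Icc_one]
    simpa using Finset.card_filter_le (Finset.Icc 1 y) Nat.Prime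
  have hbig : 2 * (N₀ + n₀ + Q * (w + 1)) ≤ y ^ 2 := by
    have h1 : Q * (w + 1) ≤ Q * (y + 3) := Nat.mul_le_mul_left Q (by omega)
    nlinarith
  rw [mul_add Q w 1, mul_one] at hbig
  set s₁ := (y ^ 2 - n₀) / Q - w
  set N := n₀ + Q * s₁ with hN
  have hdm := Nat.div_add_mod (y ^ 2 - n₀) Q
  have hml := Nat.mod_lt (y ^ 2 - n₀) hQ
  have hsw : s₁ + w = (y ^ 2 - n₀) / Q := by
    refine Nat.sub_add_cancel ?_
    rw [Nat.le_div_iff_mul_le hQ, mul_comm]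
    omega
  rw [← hsw, mul_add] at hdm
  have hNy : N + Q * w ≤ y ^ 2 := by omega
  have hNlow : y ^ 2 ≤ 2 * N := by omega
  have hshift : ∀ s, N + Q * s = n₀ + Q * (s₁ + s) := fun s => by
    rw [hN]
    ring
  refine absurd (primorial_le_of_not_infinite ht hper ha hnz hR hR1 hND (q := q) (Q := Q) (N := N)
    (y := y) (u := y ^ 2 / (2 * t)) hq (by omega) (by omega) (by omega) (by omega) (by omega)
    (fun s => ?_) (fun s => ?_) hNy ?_ (fun s l hl => ?_)) (not_le.2 hy)
  · rw [hshift]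
    exact (dvd_mul_of_dvd_left (dvd_pow_self q hφ.ne') i).add
      (dvd_mul_of_dvd_left (dvd_mul_left q t) _)
  · rwa [hshift, eq_of_modEq_of_periodic hper (by omega) hn₀ (hmodQ _)]
  · have h1 := Nat.mul_div_le (y ^ 2) (2 * t)
    rw [mul_assoc] at h1
    omega
  · exact hN₀ _ (by omega) (hshift s ▸ hmodQ _) l hl

/-- For every `a ≥ 1` there are infinitely many `b > a` with `v_{a,b} < v_{a,b-1}`. -/
theorem infinitely_many_denominator_drops
    (t : ℕ) (r : ℕ → ℤ) (ht : 1 ≤ t)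
    (hper : ∀ i, 1 ≤ i → r (i + t) = r i)
    (hnz : ∃ i, 1 ≤ i ∧ r i ≠ 0)
    (a : ℕ) (ha : 1 ≤ a) :
    {b : ℕ | a < b ∧ vab r a b < vab r a (b - 1)}.Infinite := by
  have heq : {b : ℕ | a < b ∧ vab r a b < vab r a (b - 1)} = denDrops r a := by
    simp only [vab_eq_den r ha, denDrops]
  rw [heq]
  exact denDrops_infinite ht hper hnz ha
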